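/- Let I = [a,b] ⊂ ℝ be a compact interval and let K : ℝ × ℝ → Mat_{2×2}(ℝ) be a matrix-valued function each of whose entries is infinitely differentiable and which satisfies K(x,y) = −K(y,x)ᵀ for all x,y. For l ≥ 0 set m̃_l(K,I) = max_{x,y ∈ I; 1 ≤ i,j ≤ 2} |∂^l K(x,y)_{ij}/∂y^l|. For points x₁,…,xₙ ∈ ℝ let M be the (2n)×(2n) block matrix whose (i,j) block is K(x_i,x_j); then M is antisymmetric, det M ≥ 0, and for every n ≥ 1, ∫_{Iⁿ} √(det M(x₁,…,xₙ)) dx₁⋯dxₙ ≤ (b−a)^{n(n+1)/2} · √((2n)!) · ∏_{l=0}^{n−1} m̃_l(K,I). -/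

import Mathlib

open MeasureTheory Matrix

/-- Generalized Rolle theorem. -/
theorem aux_rolle (a b : ℝ) : ∀ (k : ℕ) (g : ℝ → ℝ), ContDiff ℝ (⊤ : ℕ∞) g →
    ∀ z : Fin (k + 1) → ℝ, StrictMono z → (∀ i, z i ∈ Set.Icc a b) → (∀ i, g (z i) = 0) →
    ∃ ξ ∈ Set.Icc a b, iteratedDeriv k g ξ = 0 := by
  intro k
  induction k with
  | zero =>
    intro g _ z _ hz h0
    exact ⟨z 0, hz 0, by simpa using h0 0⟩
  | succ k ih =>
    intro g hg z hmono hz h0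
    have hd : ∀ i : Fin (k + 1), ∃ c ∈ Set.Ioo (z i.castSucc) (z i.succ), deriv g c = 0 := by
      intro i
      apply exists_deriv_eq_zero (hmono (Fin.castSucc_lt_succ))
      · exact hg.continuous.continuousOn
      · rw [h0, h0]
    choose w hw hw0 using hd
    have hg' : ContDiff ℝ (⊤ : ℕ∞) (deriv g) := by
      have : ContDiff ℝ ((⊤ : ℕ∞) + 1) g := by simpa using hg
      exact (contDiff_succ_iff_deriv.1 this).2.2
    obtain ⟨ξ, hξ, h⟩ := ih (deriv g) hg' w (by
      rw [Fin.strictMono_iff_lt_succ]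
      intro i
      calc w i.castSucc < z (i.castSucc).succ := (hw _).2
        _ = z (i.succ).castSucc := by simp
        _ < w i.succ := (hw _).1)
      (fun i => ⟨(hz _).1.trans (hw i).1.le, (hw i).2.le.trans (hz _).2⟩) hw0
    exact ⟨ξ, hξ, by rw [iteratedDeriv_succ']; exact h⟩

theorem aux_iter_poly (k : ℕ) (Q : Polynomial ℝ) :
    iteratedDeriv k (fun t => Q.eval t) = fun t => (Polynomial.derivative^[k] Q).eval t := by
  induction k with
  | zero => simp
  | succ k ih =>
    rw [iteratedDeriv_succ, ih]
    funext t
    rw [Polynomial.deriv, Function.iterate_succ_apply']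

/-- Lagrange interpolation error. -/
theorem aux_interp {ι : Type*} [DecidableEq ι] (a b : ℝ) (s : Finset ι) (x : ι → ℝ)
    (hx : ∀ i ∈ s, x i ∈ Set.Icc a b) (hinj : Set.InjOn x s) (y : ℝ) (hy : y ∈ Set.Icc a b)
    (hys : ∀ i ∈ s, y ≠ x i) (f : ℝ → ℝ) (hf : ContDiff ℝ (⊤ : ℕ∞) f) (m : ℝ)
    (hm : ∀ t ∈ Set.Icc a b, |iteratedDeriv s.card f t| ≤ m) :
    |f y - ∑ i ∈ s, f (x i) * (Lagrange.basis s x i).eval y| ≤ (b - a) ^ s.card * m := by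
  set P := Lagrange.interpolate s x (fun i => f (x i)) with hP
  set W := Lagrange.nodal s x with hW
  have hPy : P.eval y = ∑ i ∈ s, f (x i) * (Lagrange.basis s x i).eval y := by
    simp [hP, Lagrange.interpolate_apply, Polynomial.eval_finsetSum]
  rw [← hPy]
  have hWy : W.eval y ≠ 0 := Lagrange.eval_nodal_not_at_node hys
  set A := (f y - P.eval y) / W.eval y with hA
  set Q := P + Polynomial.C A * W with hQ
  have hQs : ∀ i ∈ s, Q.eval (x i) = f (x i) := by
    intro i hi
    rw [hQ, Polynomial.eval_add, Polynomial.eval_mul, hW, Lagrange.eval_nodal_at_node hi, hP,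
      Lagrange.eval_interpolate_at_node _ hinj hi, mul_zero, add_zero]
  have hQy : Q.eval y = f y := by
    simp [hQ, hA]; field_simp; ring
  have hQd : ContDiff ℝ (⊤ : ℕ∞) (fun t => Q.eval t) := by
    simpa using Q.contDiff_aeval (𝕜 := ℝ) (⊤ : ℕ∞)
  -- the zeros
  let Z : Finset ℝ := insert y (s.image x)
  have hZc : Z.card = s.card + 1 := by
    rw [Finset.card_insert_of_notMem, Finset.card_image_of_injOn hinj]
    simp only [Finset.mem_image, not_exists, not_and]
    intro i hi h; exact hys i hi h.symm
  have hZ : ∀ t ∈ Z, t ∈ Set.Icc a b ∧ f t - Q.eval t = 0 := by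
    intro t ht
    rcases Finset.mem_insert.1 ht with rfl | ht
    · exact ⟨hy, by rw [hQy, sub_self]⟩
    · obtain ⟨i, hi, rfl⟩ := Finset.mem_image.1 ht
      exact ⟨hx i hi, by rw [hQs i hi, sub_self]⟩
  obtain ⟨ξ, hξ, h0⟩ := aux_rolle a b s.card (fun t => f t - Q.eval t) (hf.sub hQd)
    (Z.orderEmbOfFin hZc) (OrderEmbedding.strictMono _)
    (fun i => (hZ _ (Finset.orderEmbOfFin_mem _ _ _)).1)
    (fun i => (hZ _ (Finset.orderEmbOfFin_mem _ _ _)).2)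
  have hsub : iteratedDeriv s.card (fun t => f t - Q.eval t) ξ
      = iteratedDeriv s.card f ξ - iteratedDeriv s.card (fun t => Q.eval t) ξ := by
    apply iteratedDeriv_fun_sub
    · exact (hf.of_le (by exact_mod_cast le_top)).contDiffAt
    · exact (hQd.of_le (by exact_mod_cast le_top)).contDiffAt
  have hdQ : Polynomial.derivative^[s.card] Q = Polynomial.C (A * (s.card.factorial : ℝ)) := by
    rw [hQ, iterate_map_add,
      Polynomial.iterate_derivative_eq_zero_of_degree_lt (Lagrange.degree_interpolate_lt _ hinj),
      zero_add, Polynomial.iterate_derivative_C_mul, map_mul]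
    congr 1
    have hnd : (Polynomial.derivative^[s.card] W).natDegree ≤ 0 := by
      have := Polynomial.natDegree_iterate_derivative W s.card
      rw [hW, Lagrange.natDegree_nodal] at this
      simpa using this
    rw [Polynomial.eq_C_of_natDegree_le_zero hnd, Polynomial.coeff_iterate_derivative]
    have : W.coeff s.card = 1 := by
      have h1 := (Lagrange.nodal_monic (s := s) (v := x)).coeff_natDegree
      rwa [Lagrange.natDegree_nodal] at h1
    simp [this, Nat.descFactorial_self]
  simp only [hsub, aux_iter_poly, hdQ, Polynomial.eval_C, sub_eq_zero] at h0
  have hAm : |A| ≤ m := by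
    have h1 := hm ξ hξ
    rw [h0, abs_mul, Nat.abs_cast] at h1
    have : (1 : ℝ) ≤ s.card.factorial := by exact_mod_cast Nat.factorial_pos _
    nlinarith [abs_nonneg A]
  have hWb : |W.eval y| ≤ (b - a) ^ s.card := by
    rw [hW, Lagrange.eval_nodal, Finset.abs_prod, ← Finset.prod_const]
    apply Finset.prod_le_prod
    · intros; positivity
    · intro i hi
      have := hx i hi
      rw [abs_le]; constructor <;> linarith [this.1, this.2, hy.1, hy.2]
  have : f y - P.eval y = W.eval y * A := by rw [hA]; field_simp
  rw [this, abs_mul]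
  exact mul_le_mul hWb hAm (abs_nonneg _) (pow_nonneg (by linarith [hy.1, hy.2]) _)

theorem aux_det_nonneg {ι : Type*} [Fintype ι] [DecidableEq ι] (M : Matrix ι ι ℝ)
    (hM : Mᵀ = -M) : 0 ≤ M.det := by
  by_contra! hneg
  let F : ℝ → ℝ := fun s => ((1 - s) • (1 : Matrix ι ι ℝ) + s • M).det
  have hF : Continuous F := by
    apply Continuous.matrix_det
    fun_prop
  have h0 : F 0 = 1 := by simp [F]
  have h1 : F 1 = M.det := by simp [F]
  obtain ⟨s, hs, hs0⟩ := intermediate_value_Icc' (zero_le_one) hF.continuousOn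
    (show (0 : ℝ) ∈ Set.Icc (F 1) (F 0) from ⟨by rw [h1]; exact hneg.le, by rw [h0]; norm_num⟩)
  have hs1 : s ≠ 1 := by
    rintro rfl
    rw [h1] at hs0; linarith
  obtain ⟨v, hv, hv0⟩ := Matrix.exists_mulVec_eq_zero_iff.2 hs0
  have hq : v ⬝ᵥ (M *ᵥ v) = 0 := by
    have e : v ⬝ᵥ (M *ᵥ v) = -(v ⬝ᵥ (M *ᵥ v)) := by
      conv_lhs => rw [Matrix.dotProduct_mulVec, ← Matrix.mulVec_transpose, hM, dotProduct_comm]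
      simp [Matrix.neg_mulVec]
    linarith
  have := congrArg (fun w => v ⬝ᵥ w) hv0
  simp only [Matrix.add_mulVec, Matrix.smul_mulVec, Matrix.one_mulVec, dotProduct_add,
    dotProduct_smul, hq, dotProduct_zero, smul_eq_mul, mul_zero, add_zero, mul_eq_zero] at this
  rcases this with h | h
  · exact hs1 (by linarith)
  · exact hv (dotProduct_self_eq_zero.1 h)

theorem aux_det_le {ι : Type*} [Fintype ι] [DecidableEq ι] (A : Matrix ι ι ℝ) (B : ι → ℝ)
    (h : ∀ p q, |A p q| ≤ B q) : |A.det| ≤ (Fintype.card ι).factorial * ∏ q, B q := by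
  rw [Matrix.det_apply]
  refine (Finset.abs_sum_le_sum_abs _ _).trans ?_
  have : ∀ σ ∈ (Finset.univ : Finset (Equiv.Perm ι)),
      |Equiv.Perm.sign σ • ∏ i, A (σ i) i| ≤ ∏ q, B q := by
    intro σ _
    have : |Equiv.Perm.sign σ • ∏ i, A (σ i) i| = ∏ i, |A (σ i) i| := by
      rw [← Finset.abs_prod]
      rcases Int.units_eq_one_or (Equiv.Perm.sign σ) with h | h <;> simp [h]
    rw [this]
    exact Finset.prod_le_prod (fun _ _ => abs_nonneg _) (fun i _ => h _ _)
  refine (Finset.sum_le_card_nsmul _ _ _ this).trans ?_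
  rw [Finset.card_univ, Fintype.card_perm, nsmul_eq_mul]

theorem aux_smooth (F : ℝ × ℝ → ℝ) (hF : ContDiff ℝ (⊤ : ℕ∞) F) (l : ℕ) :
    ContDiff ℝ (⊤ : ℕ∞) (fun p : ℝ × ℝ => iteratedDeriv l (fun t => F (p.1, t)) p.2) := by
  induction l with
  | zero => simpa using hF
  | succ l ih =>
    set G := (fun p : ℝ × ℝ => iteratedDeriv l (fun t => F (p.1, t)) p.2) with hG
    have : (fun p : ℝ × ℝ => iteratedDeriv (l + 1) (fun t => F (p.1, t)) p.2)
        = fun p => fderiv ℝ G p (0, 1) := by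
      funext p
      rw [iteratedDeriv_succ]
      have h1 : HasFDerivAt G (fderiv ℝ G p) (p.1, p.2) :=
        (ih.differentiable (by simp) p).hasFDerivAt
      have h2 : HasDerivAt (fun t : ℝ => (p.1, t)) ((0 : ℝ), (1 : ℝ)) p.2 :=
        (hasDerivAt_const _ _).prodMk (hasDerivAt_id _)
      exact (h1.comp_hasDerivAt p.2 h2).deriv
    rw [this]
    exact (ih.fderiv_right (m := (⊤ : ℕ∞)) (by simp)).clm_apply contDiff_const

theorem stmt5 (a b : ℝ) (hab : a ≤ b)
    (K : ℝ → ℝ → Matrix (Fin 2) (Fin 2) ℝ)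
    (hsmooth : ∀ i j : Fin 2, ContDiff ℝ (⊤ : ℕ∞) (fun p : ℝ × ℝ => K p.1 p.2 i j))
    (hanti : ∀ x y : ℝ, K x y = -(K y x)ᵀ)
    (n : ℕ) (hn : 1 ≤ n) :
    (∀ x : Fin n → ℝ,
      (Matrix.of fun p q : Fin n × Fin 2 => K (x p.1) (x q.1) p.2 q.2)ᵀ =
        -(Matrix.of fun p q : Fin n × Fin 2 => K (x p.1) (x q.1) p.2 q.2)) ∧
    (∀ x : Fin n → ℝ,
      0 ≤ (Matrix.of fun p q : Fin n × Fin 2 => K (x p.1) (x q.1) p.2 q.2).det) ∧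
    (∫ x : Fin n → ℝ in Set.pi Set.univ (fun _ => Set.Icc a b),
        Real.sqrt (Matrix.of fun p q : Fin n × Fin 2 => K (x p.1) (x q.1) p.2 q.2).det) ≤
      (b - a) ^ (n * (n + 1) / 2) * Real.sqrt (Nat.factorial (2 * n)) *
        ∏ l ∈ Finset.range n,
          sSup {v : ℝ | ∃ x ∈ Set.Icc a b, ∃ y ∈ Set.Icc a b, ∃ i : Fin 2, ∃ j : Fin 2,
            v = |iteratedDeriv l (fun t => K x t i j) y|} := by
  have hT : ∀ x : Fin n → ℝ,
      (Matrix.of fun p q : Fin n × Fin 2 => K (x p.1) (x q.1) p.2 q.2)ᵀ =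
        -(Matrix.of fun p q : Fin n × Fin 2 => K (x p.1) (x q.1) p.2 q.2) := by
    intro x
    ext p q
    have := congrFun (congrFun (hanti (x q.1) (x p.1)) q.2) p.2
    simpa using this
  refine ⟨hT, fun x => aux_det_nonneg _ (hT x), ?_⟩
  set m : ℕ → ℝ := fun l => sSup {v : ℝ | ∃ x ∈ Set.Icc a b, ∃ y ∈ Set.Icc a b,
    ∃ i : Fin 2, ∃ j : Fin 2, v = |iteratedDeriv l (fun t => K x t i j) y|} with hmdef
  have hm0 : ∀ l, 0 ≤ m l := by
    intro l
    apply Real.sSup_nonneg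
    rintro v ⟨x, _, y, _, i, j, rfl⟩
    exact abs_nonneg _
  have hm : ∀ l, ∀ x ∈ Set.Icc a b, ∀ y ∈ Set.Icc a b, ∀ i j : Fin 2,
      |iteratedDeriv l (fun t => K x t i j) y| ≤ m l := by
    intro l x hx y hy i j
    refine le_csSup ?_ ⟨x, hx, y, hy, i, j, rfl⟩
    have hb : ∀ i j : Fin 2, ∃ C : ℝ, ∀ p ∈ Set.Icc a b ×ˢ Set.Icc a b,
        ‖iteratedDeriv l (fun t => K p.1 t i j) p.2‖ ≤ C := fun i j =>
      (isCompact_Icc.prod isCompact_Icc).exists_bound_of_continuousOn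
        (aux_smooth _ (hsmooth i j) l).continuous.continuousOn
    choose C hC using hb
    refine ⟨∑ i, ∑ j, |C i j|, ?_⟩
    rintro v ⟨x, hx, y, hy, i, j, rfl⟩
    calc |iteratedDeriv l (fun t => K x t i j) y| ≤ C i j := hC i j (x, y) ⟨hx, hy⟩
      _ ≤ |C i j| := le_abs_self _
      _ ≤ ∑ j, |C i j| := Finset.single_le_sum (f := fun j => |C i j|)
          (fun _ _ => abs_nonneg _) (Finset.mem_univ j)
      _ ≤ _ := Finset.single_le_sum (f := fun i => ∑ j, |C i j|)
          (fun _ _ => Finset.sum_nonneg fun _ _ => abs_nonneg _) (Finset.mem_univ i)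
  clear_value m
  have hba : 0 ≤ b - a := by linarith
  set D : ℝ := ∏ l ∈ Finset.range n, ((b - a) ^ l * m l) with hD
  have hD0 : 0 ≤ D := Finset.prod_nonneg fun l _ => mul_nonneg (pow_nonneg hba _) (hm0 l)
  have hpt : ∀ x ∈ Set.pi Set.univ (fun _ : Fin n => Set.Icc a b),
      ‖Real.sqrt (Matrix.of fun p q : Fin n × Fin 2 => K (x p.1) (x q.1) p.2 q.2).det‖
        ≤ Real.sqrt (Nat.factorial (2 * n)) * D := by
    intro x hx
    have hx' : ∀ i, x i ∈ Set.Icc a b := fun i => hx i (Set.mem_univ i)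
    rw [Real.norm_of_nonneg (Real.sqrt_nonneg _)]
    have key : (Matrix.of fun p q : Fin n × Fin 2 => K (x p.1) (x q.1) p.2 q.2).det
        ≤ (Nat.factorial (2 * n)) * D ^ 2 := by
      set M := (Matrix.of fun p q : Fin n × Fin 2 => K (x p.1) (x q.1) p.2 q.2) with hM
      by_cases hinj : Function.Injective x
      · let U : Matrix (Fin n) (Fin n) ℝ := Matrix.of fun i j =>
          if i = j then 1 else if i < j then
            -(Lagrange.basis (Finset.Iio j) x i).eval (x j) else 0
        have hU : U.det = 1 := by
          rw [Matrix.det_of_isUpperTriangular]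
          · simp [U]
          · intro i j hij
            simp only [id] at hij
            simp [U, hij.ne', hij.not_gt]
        have hdet : M.det = (M * Matrix.kronecker U (1 : Matrix (Fin 2) (Fin 2) ℝ)).det := by
          have h := Matrix.det_kronecker U (1 : Matrix (Fin 2) (Fin 2) ℝ)
          rw [hU] at h
          rw [Matrix.det_mul, Matrix.kronecker, h]; simp
        have hent : ∀ p q, (M * Matrix.kronecker U (1 : Matrix (Fin 2) (Fin 2) ℝ)) p q
            = K (x p.1) (x q.1) p.2 q.2 - ∑ i ∈ Finset.Iio q.1, K (x p.1) (x i) p.2 q.2 *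
              (Lagrange.basis (Finset.Iio q.1) x i).eval (x q.1) := by
          intro p q
          rw [Matrix.mul_apply, Fintype.sum_prod_type]
          have : ∀ i : Fin n, ∑ s : Fin 2, M p (i, s) *
              Matrix.kronecker U (1 : Matrix (Fin 2) (Fin 2) ℝ) (i, s) q
              = K (x p.1) (x i) p.2 q.2 * U i q.1 := by
            intro i
            rw [Finset.sum_eq_single q.2]
            · simp [hM, Matrix.kronecker, Matrix.kroneckerMap_apply]
            · intro s _ hs
              simp [Matrix.kronecker, Matrix.kroneckerMap_apply, Matrix.one_apply_ne hs]
            · simp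
          simp_rw [this]
          have h2 : ∀ i : Fin n, K (x p.1) (x i) p.2 q.2 * U i q.1
              = (if i = q.1 then K (x p.1) (x i) p.2 q.2 else 0)
                - (if i ∈ Finset.Iio q.1 then K (x p.1) (x i) p.2 q.2 *
                  (Lagrange.basis (Finset.Iio q.1) x i).eval (x q.1) else 0) := by
            intro i
            by_cases h : i = q.1
            · simp [U, h]
            · by_cases h' : i < q.1 <;> simp [U, h, h']
          simp_rw [h2]
          rw [Finset.sum_sub_distrib, Finset.sum_ite_eq', Finset.sum_ite_mem]
          simp
        rw [hdet]
        refine (le_abs_self _).trans ((aux_det_le _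
          (fun q => (b - a) ^ (q.1 : ℕ) * m q.1) ?_).trans_eq ?_)
        · intro p q
          rw [hent]
          have := aux_interp a b (Finset.Iio q.1) x (fun i _ => hx' i) hinj.injOn (x q.1)
            (hx' q.1) (fun i hi h => (Finset.mem_Iio.1 hi).ne (hinj h).symm)
            (fun t => K (x p.1) t p.2 q.2)
            ((hsmooth p.2 q.2).comp (contDiff_const.prodMk contDiff_id)) (m q.1)
            (by
              intro t ht
              rw [Fin.card_Iio]
              exact hm _ _ (hx' _) _ ht _ _)
          rwa [Fin.card_Iio] at this
        · rw [Fintype.card_prod, Fintype.card_fin, Fintype.card_fin, mul_comm n 2]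
          congr 1
          rw [Fintype.prod_prod_type, hD, ← Fin.prod_univ_eq_prod_range
            (fun l => (b - a) ^ l * m l), ← Finset.prod_pow]
          simp
      · have : M.det = 0 := by
          simp only [Function.Injective, not_forall] at hinj
          obtain ⟨i, j, hij, hne⟩ := hinj
          apply Matrix.det_zero_of_row_eq (i := (i, 0)) (j := (j, 0))
          · simpa using hne
          · funext q
            simp [hM, hij]
        rw [this]; positivity
    calc _ ≤ Real.sqrt ((Nat.factorial (2 * n)) * D ^ 2) := Real.sqrt_le_sqrt key
      _ = _ := by rw [Real.sqrt_mul (by positivity), Real.sqrt_sq hD0]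
  have hvol : volume (Set.pi Set.univ (fun _ : Fin n => Set.Icc a b))
      = ENNReal.ofReal ((b - a) ^ n) := by
    rw [volume_pi_pi]; simp [Real.volume_Icc, ENNReal.ofReal_pow hba]
  have hfin := norm_setIntegral_le_of_norm_le_const (μ := volume)
    (by rw [hvol]; exact ENNReal.ofReal_lt_top) hpt
  refine (le_abs_self _).trans (hfin.trans_eq ?_)
  rw [Measure.real, hvol, ENNReal.toReal_ofReal (pow_nonneg hba _), hD, Finset.prod_mul_distrib,
    Finset.prod_pow_eq_pow_sum, Finset.sum_range_id]
  have : n * (n + 1) / 2 = n * (n - 1) / 2 + n := by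
    have h := Finset.sum_range_succ (fun i => i) n
    rw [Finset.sum_range_id, Finset.sum_range_id] at h
    simpa [mul_comm] using h
  rw [this, pow_add]
  ring
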